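/- arXiv:2104.03720 — 11 statements merged into one kernel-verified Lean document; each statement's English description precedes it below -/
import Mathlib

section
/- Let h_d > 0, η1 ≥ 0, η2 ≥ 0 and σ² > 0 be real numbers, and define the D2D sum-rate R(P1, P2) = log₂(1 + P1·h_d/(P2·η2 + σ²)) + log₂(1 + P2·h_d/(P1·η1 + σ²)). Then for all P1 ≥ 0, P2 ≥ 0 with P1 + P2 > 0 and every real β > 1, one has R(β·P1, β·P2) > R(P1, P2). -/
theorem logb_one_add_sinr_lt_of_scaling {h η s p q β : ℝ} (hh : 0 < h) (hη : 0 ≤ η) (hs : 0 < s)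
    (hp : 0 < p) (hq : 0 ≤ q) (hβ : 1 < β) :
    Real.logb 2 (1 + p * h / (q * η + s)) <
      Real.logb 2 (1 + β * p * h / (β * q * η + s)) := by
  have hβ0 : 0 < β := by linarith
  have hlt : p * h / (q * η + s) < β * p * h / (β * q * η + s) := by
    rw [div_lt_div_iff₀ (by positivity) (by positivity)]
    have : 0 < (β - 1) * (p * h * s) := mul_pos (by linarith) (by positivity)
    linarith
  exact Real.logb_lt_logb (by norm_num) (by positivity) (by linarith)

theorem logb_one_add_sinr_le_of_scaling {h η s p q β : ℝ} (hh : 0 < h) (hη : 0 ≤ η) (hs : 0 < s)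
    (hp : 0 ≤ p) (hq : 0 ≤ q) (hβ : 1 < β) :
    Real.logb 2 (1 + p * h / (q * η + s)) ≤
      Real.logb 2 (1 + β * p * h / (β * q * η + s)) := by
  rcases hp.eq_or_lt with rfl | hp
  · simp
  · exact (logb_one_add_sinr_lt_of_scaling hh hη hs hp hq hβ).le


theorem d2d_rate_increases_under_scaling
    (hd η1 η2 σ2 : ℝ) (hhd : 0 < hd) (hη1 : 0 ≤ η1) (hη2 : 0 ≤ η2) (hσ2 : 0 < σ2)
    (R : ℝ → ℝ → ℝ)
    (hR : ∀ P1 P2 : ℝ, R P1 P2 =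
      Real.logb 2 (1 + P1 * hd / (P2 * η2 + σ2)) +
      Real.logb 2 (1 + P2 * hd / (P1 * η1 + σ2)))
    (P1 P2 : ℝ) (hP1 : 0 ≤ P1) (hP2 : 0 ≤ P2) (hsum : 0 < P1 + P2)
    (β : ℝ) (hβ : 1 < β) :
    R (β * P1) (β * P2) > R P1 P2 := by
  rw [hR, hR, gt_iff_lt]
  rcases hP1.eq_or_lt with h0 | hpos
  · exact add_lt_add_of_le_of_lt (logb_one_add_sinr_le_of_scaling hhd hη2 hσ2 hP1 hP2 hβ)
      (logb_one_add_sinr_lt_of_scaling hhd hη1 hσ2 (by linarith) hP1 hβ)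
  · exact add_lt_add_of_lt_of_le (logb_one_add_sinr_lt_of_scaling hhd hη2 hσ2 hpos hP2 hβ)
      (logb_one_add_sinr_le_of_scaling hhd hη1 hσ2 hP2 hP1 hβ)
end

section
/- Consider the feasible set S of triples (P1, P2, Pu) of real numbers satisfying PMC1, PMC2, PMC3, PMC4 together with the box constraints 0 ≤ P1 ≤ P1M, 0 ≤ P2 ≤ P2M, Pum ≤ Pu ≤ PuM (where P1M, P2M, PuM > 0 and Pum > 0). Define R(P1, P2) = log₂(1 + P1·h_d/(P2·η2 + σ²)) + log₂(1 + P2·h_d/(P1·η1 + σ²)) with σ² > 0. If (P1, P2, Pu) ∈ S satisfies P1 < P1M, P2 < P2M and Pu < PuM, then there exists (P1', P2', Pu') ∈ S with R(P1', P2') > R(P1, P2). Hence any maximizer of R over S lies on one of the outer sides P1 = P1M, P2 = P2M or Pu = PuM. -/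
/-- Scaling both powers by a factor larger than one strictly increases the rate of a link with
positive noise power. -/
lemma logb_one_add_sinr_lt_of_scale {P Q h η s β : ℝ} (hP : 0 < P) (hQ : 0 < Q) (hh : 0 < h)
    (hη : 0 < η) (hs : 0 < s) (hβ : 1 < β) :
    Real.logb 2 (1 + P * h / (Q * η + s)) <
      Real.logb 2 (1 + β * P * h / (β * Q * η + s)) := by
  have hβ0 : 0 < β := by linarith
  have key : P * h / (Q * η + s) < β * P * h / (β * Q * η + s) := by
    rw [div_lt_div_iff₀ (by positivity) (by positivity)]
    have : 0 < P * h * s * (β - 1) := mul_pos (by positivity) (by linarith)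
    linarith
  exact Real.logb_lt_logb (by norm_num) (by positivity) (by linarith)

theorem fd_sic_optimum_on_outer_sides
    (hd hbu hbd1 hbd2 hd1u hd2u η1 η2 σ2 : ℝ)
    (hhd : 0 < hd) (hhbu : 0 < hbu) (hhbd1 : 0 < hbd1) (hhbd2 : 0 < hbd2)
    (hhd1u : 0 < hd1u) (hhd2u : 0 < hd2u) (hη1 : 0 < η1) (hη2 : 0 < η2)
    (hσ2 : 0 < σ2)
    (P1M P2M PuM Pum : ℝ)
    (hP1M : 0 < P1M) (hP2M : 0 < P2M) (hPuM : 0 < PuM) (hPum : 0 < Pum)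
    (S : ℝ × ℝ × ℝ → Prop)
    (hS : ∀ p : ℝ × ℝ × ℝ, S p ↔
      (p.2.1 * hbd2 > p.1 * hbd1 + p.2.2 * hbu) ∧
      (p.2.2 * hd1u > p.2.1 * hd + p.1 * η1) ∧
      (p.1 * hbd1 > p.2.2 * hbu) ∧
      (p.2.2 * hd2u > p.1 * hd + p.2.1 * η2) ∧
      (0 ≤ p.1 ∧ p.1 ≤ P1M) ∧ (0 ≤ p.2.1 ∧ p.2.1 ≤ P2M) ∧
      (Pum ≤ p.2.2 ∧ p.2.2 ≤ PuM))
    (R : ℝ → ℝ → ℝ)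
    (hR : ∀ P1 P2 : ℝ, R P1 P2 =
      Real.logb 2 (1 + P1 * hd / (P2 * η2 + σ2)) +
      Real.logb 2 (1 + P2 * hd / (P1 * η1 + σ2)))
    (P1 P2 Pu : ℝ) (hmem : S (P1, P2, Pu))
    (h1 : P1 < P1M) (h2 : P2 < P2M) (h3 : Pu < PuM) :
    ∃ P1' P2' Pu' : ℝ, S (P1', P2', Pu') ∧ R P1' P2' > R P1 P2 := by
  obtain ⟨c1, c2, c3, c4, -, -, c7, -⟩ := (hS _).1 hmem
  dsimp only at c1 c2 c3 c4 c7
  have hPu : 0 < Pu := by linarith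
  have hP1 : 0 < P1 := pos_of_mul_pos_left ((mul_pos hPu hhbu).trans c3) hhbd1.le
  have hP2 : 0 < P2 :=
    pos_of_mul_pos_left ((add_pos (mul_pos hP1 hhbd1) (mul_pos hPu hhbu)).trans c1) hhbd2.le
  obtain ⟨β, hβ, b1, b2, b3⟩ :
      ∃ β : ℝ, 1 < β ∧ β * P1 ≤ P1M ∧ β * P2 ≤ P2M ∧ β * Pu ≤ PuM := by
    refine ⟨min (P1M / P1) (min (P2M / P2) (PuM / Pu)), ?_, ?_, ?_, ?_⟩
    · exact lt_min ((one_lt_div hP1).2 h1) (lt_min ((one_lt_div hP2).2 h2) ((one_lt_div hPu).2 h3))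
    · exact (le_div_iff₀ hP1).1 (min_le_left _ _)
    · exact (le_div_iff₀ hP2).1 ((min_le_right _ _).trans (min_le_left _ _))
    · exact (le_div_iff₀ hPu).1 ((min_le_right _ _).trans (min_le_right _ _))
  have hβ0 : 0 < β := by linarith
  refine ⟨β * P1, β * P2, β * Pu, (hS _).2 ⟨?_, ?_, ?_, ?_, ⟨?_, b1⟩, ⟨?_, b2⟩, ?_, b3⟩, ?_⟩
  · linarith [mul_lt_mul_of_pos_left c1 hβ0]
  · linarith [mul_lt_mul_of_pos_left c2 hβ0]
  · linarith [mul_lt_mul_of_pos_left c3 hβ0]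
  · linarith [mul_lt_mul_of_pos_left c4 hβ0]
  · positivity
  · positivity
  · exact c7.trans (le_mul_of_one_le_left hPu.le hβ.le)
  · rw [hR, hR]
    exact add_lt_add (logb_one_add_sinr_lt_of_scale hP1 hP2 hhd hη2 hσ2 hβ)
      (logb_one_add_sinr_lt_of_scale hP2 hP1 hhd hη1 hσ2 hβ)
end

section
/- Let h_d, h_{b,u}, h_{b,d1}, h_{b,d2}, h_{d1,u}, η1 be positive reals and P1 ≥ 0, P2, Pu real. If PMC1: P2·h_{b,d2} > P1·h_{b,d1} + Pu·h_{b,u} and PMC2: Pu·h_{d1,u} > P2·h_d + P1·η1 both hold, then P1·(h_{b,d2}·η1 − h_d·h_{b,d1}) + Pu·(h_{d1,u}·h_{b,d2} − h_d·h_{b,u}) > 0. -/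
theorem pmc12_imply_sic_m2_at_bs
    (hd hbu hbd1 hbd2 hd1u η1 : ℝ)
    (hhd : 0 < hd) (hhbu : 0 < hbu) (hhbd1 : 0 < hbd1) (hhbd2 : 0 < hbd2)
    (hhd1u : 0 < hd1u) (hη1 : 0 < η1)
    (P1 P2 Pu : ℝ) (hP1 : 0 ≤ P1)
    (pmc1 : P2 * hbd2 > P1 * hbd1 + Pu * hbu)
    (pmc2 : Pu * hd1u > P2 * hd + P1 * η1) :
    P1 * (hbd2 * η1 - hd * hbd1) + Pu * (hd1u * hbd2 - hd * hbu) > 0 := by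
  have h1 := mul_lt_mul_of_pos_left pmc1 hhd
  have h2 := mul_lt_mul_of_pos_left pmc2 hhbd2
  have h3 : 0 ≤ P1 * (hbd2 * η1) := by positivity
  linarith
end

section
/- Let h_d, h_{b,u}, h_{b,d1}, h_{b,d2}, h_{d1,u}, η1 be positive reals and P1, P2, Pu positive reals. If PMC1: P2·h_{b,d2} > P1·h_{b,d1} + Pu·h_{b,u} and PMC2: Pu·h_{d1,u} > P2·h_d + P1·η1 both hold, then Pu·(h_{d1,u}·h_{b,d2} − h_{b,u}·h_d) > P1·(h_{b,d1}·h_d + η1·h_{b,d2}); in particular h_{d1,u}·h_{b,d2} > h_{b,u}·h_d. -/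
theorem pmc12_eliminate_P2
    (hd hbu hbd1 hbd2 hd1u η1 : ℝ)
    (hhd : 0 < hd) (hhbu : 0 < hbu) (hhbd1 : 0 < hbd1) (hhbd2 : 0 < hbd2)
    (hhd1u : 0 < hd1u) (hη1 : 0 < η1)
    (P1 P2 Pu : ℝ) (hP1 : 0 < P1) (hP2 : 0 < P2) (hPu : 0 < Pu)
    (pmc1 : P2 * hbd2 > P1 * hbd1 + Pu * hbu)
    (pmc2 : Pu * hd1u > P2 * hd + P1 * η1) :
    Pu * (hd1u * hbd2 - hbu * hd) > P1 * (hbd1 * hd + η1 * hbd2) ∧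
    hd1u * hbd2 > hbu * hd := by
  have key : Pu * (hd1u * hbd2 - hbu * hd) > P1 * (hbd1 * hd + η1 * hbd2) := by
    linarith [mul_lt_mul_of_pos_right pmc1 hhd, mul_lt_mul_of_pos_right pmc2 hhbd2]
  have hpos : 0 < P1 * (hbd1 * hd + η1 * hbd2) := by positivity
  exact ⟨key, sub_pos.mp (pos_of_mul_pos_right (hpos.trans key) hPu.le)⟩
end

section
/- Let h_d, h_{b,u}, h_{b,d1}, h_{d1,u}, η1 be positive reals and P1, P2, Pu positive reals. If PMC3: P1·h_{b,d1} > Pu·h_{b,u} and PMC2: Pu·h_{d1,u} > P2·h_d + P1·η1 both hold, then P1·(h_{b,d1}·h_{d1,u} − η1·h_{b,u}) > P2·h_d·h_{b,u}; in particular h_{b,d1}·h_{d1,u} > η1·h_{b,u}. -/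
theorem pmc23_necessary_condition
    (hd hbu hbd1 hd1u η1 : ℝ)
    (hhd : 0 < hd) (hhbu : 0 < hbu) (hhbd1 : 0 < hbd1)
    (hhd1u : 0 < hd1u) (hη1 : 0 < η1)
    (P1 P2 Pu : ℝ) (hP1 : 0 < P1) (hP2 : 0 < P2) (hPu : 0 < Pu)
    (pmc3 : P1 * hbd1 > Pu * hbu)
    (pmc2 : Pu * hd1u > P2 * hd + P1 * η1) :
    P1 * (hbd1 * hd1u - η1 * hbu) > P2 * hd * hbu ∧
    hbd1 * hd1u > η1 * hbu := by
  have key : P1 * (hbd1 * hd1u - η1 * hbu) > P2 * hd * hbu := by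
    have h3 := mul_lt_mul_of_pos_right pmc3 hhd1u
    have h2 := mul_lt_mul_of_pos_right pmc2 hhbu
    linarith
  have hpos : 0 < P1 * (hbd1 * hd1u - η1 * hbu) := lt_trans (by positivity) key
  exact ⟨key, sub_pos.mp (pos_of_mul_pos_right hpos hP1.le)⟩
end

section
/- Let h_d, h_{b,u}, h_{b,d1}, h_{b,d2}, h_{d2,u}, η2 be positive reals and P1, P2, Pu positive reals. If PMC1: P2·h_{b,d2} > P1·h_{b,d1} + Pu·h_{b,u} and PMC4: Pu·h_{d2,u} > P1·h_d + P2·η2 both hold, then P2·(h_{b,d2}·h_{d2,u} − η2·h_{b,u}) > P1·(h_{b,d1}·h_{d2,u} + h_d·h_{b,u}); in particular h_{b,d2}·h_{d2,u} > η2·h_{b,u}. -/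
theorem pmc14_necessary_condition
    (hd hbu hbd1 hbd2 hd2u η2 : ℝ)
    (hhd : 0 < hd) (hhbu : 0 < hbu) (hhbd1 : 0 < hbd1) (hhbd2 : 0 < hbd2)
    (hhd2u : 0 < hd2u) (hη2 : 0 < η2)
    (P1 P2 Pu : ℝ) (hP1 : 0 < P1) (hP2 : 0 < P2) (hPu : 0 < Pu)
    (pmc1 : P2 * hbd2 > P1 * hbd1 + Pu * hbu)
    (pmc4 : Pu * hd2u > P1 * hd + P2 * η2) :
    P2 * (hbd2 * hd2u - η2 * hbu) > P1 * (hbd1 * hd2u + hd * hbu) ∧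
    hbd2 * hd2u > η2 * hbu := by
  have key : P2 * (hbd2 * hd2u - η2 * hbu) > P1 * (hbd1 * hd2u + hd * hbu) := by
    linarith [mul_lt_mul_of_pos_right pmc1 hhd2u, mul_lt_mul_of_pos_right pmc4 hhbu]
  have lower_pos : 0 < P1 * (hbd1 * hd2u + hd * hbu) := by positivity
  exact ⟨key, sub_pos.mp (pos_of_mul_pos_right (lower_pos.trans key) hP2.le)⟩
end

section
/- Let h_d, h_{b,u}, h_{b,d1}, h_{b,d2}, h_{d1,u}, h_{d2,u}, η1, η2 be positive reals and let P1M, P2M, PuM, Pum be positive reals with Pum ≤ PuM. Then there exists a triple (P1, P2, Pu) of reals with 0 ≤ P1 ≤ P1M, 0 ≤ P2 ≤ P2M, Pum ≤ Pu ≤ PuM satisfying PMC1, PMC2, PMC3 and PMC4 if and only if the three conditions hold: (i) h_{b,d1}·h_{d1,u} − η1·h_{b,u} > 2·h_{b,u}·h_d·(h_{b,d1}/h_{b,d2}); (ii) h_{b,d1}·h_{d2,u} − h_{b,u}·h_d > 2·h_{b,u}·η2·(h_{b,d1}/h_{b,d2}); (iii) Pum·h_{b,u}/h_{b,d1} < P1M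 and 2·Pum·h_{b,u}/h_{b,d2} < P2M. -/
open Filter Topology in
/-- A linear function of `t` stays below any positive bound as `t` decreases to `0`. -/
lemma eventually_mul_lt_nhdsGT_zero (k : ℝ) {x : ℝ} (hx : 0 < x) :
    ∀ᶠ t in 𝓝[>] (0 : ℝ), k * t < x := by
  have h : Tendsto (fun t : ℝ => k * t) (𝓝[>] 0) (𝓝 (k * 0)) :=
    ((continuous_const_mul k).tendsto 0).mono_left nhdsWithin_le_nhds
  exact h.eventually_lt_const (by simpa using hx)

/-- Clearing denominators in the channel-gain conditions. -/
lemma two_mul_div_lt_sub_iff {a b c : ℝ} (hb : 0 < b) (x y z : ℝ) :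
    b * x - y * a > 2 * a * z * (b / c) ↔ a / b * y + 2 * (a / c) * z < x := by
  have h : b * x - y * a - 2 * a * z * (b / c) =
      b * (x - (a / b * y + 2 * (a / c) * z)) := by
    field_simp
    ring
  rw [gt_iff_lt, ← sub_pos, h, mul_pos_iff_of_pos_left hb, sub_pos]

theorem fd_sic_feasibility_iff
    (hd hbu hbd1 hbd2 hd1u hd2u η1 η2 : ℝ)
    (hhd : 0 < hd) (hhbu : 0 < hbu) (hhbd1 : 0 < hbd1) (hhbd2 : 0 < hbd2)
    (hhd1u : 0 < hd1u) (hhd2u : 0 < hd2u) (hη1 : 0 < η1) (hη2 : 0 < η2)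
    (P1M P2M PuM Pum : ℝ)
    (hP1M : 0 < P1M) (hP2M : 0 < P2M) (hPuM : 0 < PuM) (hPum : 0 < Pum)
    (hmM : Pum ≤ PuM) :
    (∃ P1 P2 Pu : ℝ,
      0 ≤ P1 ∧ P1 ≤ P1M ∧ 0 ≤ P2 ∧ P2 ≤ P2M ∧ Pum ≤ Pu ∧ Pu ≤ PuM ∧
      P2 * hbd2 > P1 * hbd1 + Pu * hbu ∧
      Pu * hd1u > P2 * hd + P1 * η1 ∧
      P1 * hbd1 > Pu * hbu ∧
      Pu * hd2u > P1 * hd + P2 * η2) ↔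
    (hbd1 * hd1u - η1 * hbu > 2 * hbu * hd * (hbd1 / hbd2) ∧
     hbd1 * hd2u - hbu * hd > 2 * hbu * η2 * (hbd1 / hbd2) ∧
     (Pum * hbu / hbd1 < P1M ∧ 2 * Pum * hbu / hbd2 < P2M)) := by
  have hr1 : hbu / hbd1 * hbd1 = hbu := div_mul_cancel₀ _ hhbd1.ne'
  have hr2 : hbu / hbd2 * hbd2 = hbu := div_mul_cancel₀ _ hhbd2.ne'
  have hk : hbd1 / hbd2 * hbd2 = hbd1 := div_mul_cancel₀ _ hhbd2.ne'
  rw [two_mul_div_lt_sub_iff hhbd1, mul_comm hbu hd, two_mul_div_lt_sub_iff hhbd1,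
    mul_div_assoc, mul_div_assoc]
  set r1 := hbu / hbd1
  set r2 := hbu / hbd2
  set k := hbd1 / hbd2
  constructor
  · rintro ⟨P1, P2, Pu, -, hP1, -, hP2, hPu, -, h1, h2, h3, h4⟩
    have hPu0 : 0 < Pu := hPum.trans_le hPu
    have hr1pos : 0 < r1 := div_pos hhbu hhbd1
    have hr2pos : 0 < r2 := div_pos hhbu hhbd2
    have hlow1 : Pu * r1 < P1 := by
      refine lt_of_mul_lt_mul_right ?_ hhbd1.le
      rw [mul_assoc, hr1]
      exact h3
    have hlow2 : 2 * Pu * r2 < P2 := by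
      refine lt_of_mul_lt_mul_right ?_ hhbd2.le
      rw [mul_assoc, hr2]
      linarith
    have hm1 := mul_le_mul_of_nonneg_right hPu hr1pos.le
    have hm2 := mul_le_mul_of_nonneg_right hPu hr2pos.le
    refine ⟨?_, ?_, by linarith, by linarith⟩
    · refine lt_of_mul_lt_mul_left ?_ hPu0.le
      linarith [mul_lt_mul_of_pos_right hlow1 hη1, mul_lt_mul_of_pos_right hlow2 hhd]
    · refine lt_of_mul_lt_mul_left ?_ hPu0.le
      linarith [mul_lt_mul_of_pos_right hlow1 hhd, mul_lt_mul_of_pos_right hlow2 hη2]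
  · rintro ⟨hi, hii, h1M, h2M⟩
    have hr1pos : 0 < r1 := div_pos hhbu hhbd1
    have hr2pos : 0 < r2 := div_pos hhbu hhbd2
    have hkpos : 0 < k := div_pos hhbd1 hhbd2
    obtain ⟨t, e1, e2, e3, e4, ht⟩ :=
      ((eventually_mul_lt_nhdsGT_zero 1 (sub_pos.2 h1M)).and
        ((eventually_mul_lt_nhdsGT_zero (2 * k) (sub_pos.2 h2M)).and
        ((eventually_mul_lt_nhdsGT_zero (η1 + 2 * k * hd)
          (mul_pos hPum (sub_pos.2 hi))).and
        ((eventually_mul_lt_nhdsGT_zero (hd + 2 * k * η2)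
          (mul_pos hPum (sub_pos.2 hii))).and
        self_mem_nhdsWithin)))).exists
    have ht : 0 < t := ht
    have htb := mul_pos ht hhbd1
    have hP1 : (Pum * r1 + t) * hbd1 = Pum * hbu + t * hbd1 := by
      rw [← hr1]; ring
    have hP2 : (2 * Pum * r2 + 2 * k * t) * hbd2 = 2 * (Pum * hbu) + 2 * (t * hbd1) := by
      linear_combination 2 * Pum * hr2 + 2 * t * hk
    refine ⟨Pum * r1 + t, 2 * Pum * r2 + 2 * k * t, Pum, by positivity, by linarith,
      by positivity, by linarith, le_rfl, hmM, ?_, by linarith, ?_, by linarith⟩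
    · rw [hP1, hP2]; linarith
    · rw [hP1]; linarith
end

section
/- Let h > 0, Q > 0, σ² > 0, η1 ≥ 0, η2 ≥ 0 be reals and define F(x) = log₂(1 + x·h/(Q·η2 + σ²)) + log₂(1 + Q·h/(x·η1 + σ²)) for x ≥ 0. Then for all reals 0 ≤ l ≤ x ≤ u, F(x) ≤ max(F(l), F(u)). -/
/-- The product of a nondecreasing affine function and `1 + b / (affine)` is quasiconvex:
cleared of its denominator, a sublevel condition is a convex quadratic inequality. -/
theorem mul_one_add_div_le_max {a b c s l x u : ℝ} (ha : 0 ≤ a) (hc : 0 ≤ c) (hs : 0 < s)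
    (hl : 0 ≤ l) (hlx : l ≤ x) (hxu : x ≤ u) :
    (1 + a * x) * (1 + b / (x * c + s)) ≤
      max ((1 + a * l) * (1 + b / (l * c + s))) ((1 + a * u) * (1 + b / (u * c + s))) := by
  have key : ∀ t, 0 ≤ t → ∀ M, (1 + a * t) * (1 + b / (t * c + s)) < M →
      (1 + a * t) * (t * c + s + b) - M * (t * c + s) < 0 := by
    intro t ht M hM
    have hpos : 0 < t * c + s := by positivity
    have := mul_lt_mul_of_pos_right hM hpos
    have e : (1 + a * t) * (1 + b / (t * c + s)) * (t * c + s) =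
        (1 + a * t) * (t * c + s + b) := by field_simp
    linarith
  by_contra! hlt
  obtain ⟨h1, h2⟩ := max_lt_iff.1 hlt
  have hx : 0 < x * c + s := by have := hl.trans hlx; positivity
  have e : (1 + a * x) * (1 + b / (x * c + s)) * (x * c + s) =
      (1 + a * x) * (x * c + s + b) := by field_simp
  have hlx' : l < x := hlx.lt_of_ne (by rintro rfl; exact lt_irrefl _ h1)
  have k1 := key l hl _ h1
  have k2 := key u (hl.trans (hlx.trans hxu)) _ h2
  generalize (1 + a * x) * (1 + b / (x * c + s)) = M at *
  have h3 := mul_nonpos_of_nonneg_of_nonpos (sub_nonneg.2 hxu) k1.le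
  have h4 := mul_neg_of_pos_of_neg (sub_pos.2 hlx') k2
  have h5 : 0 ≤ a * c * ((u - l) * (x - l) * (u - x)) :=
    mul_nonneg (mul_nonneg ha hc) (mul_nonneg (mul_nonneg (by linarith) (by linarith))
      (by linarith))
  refine lt_irrefl (0 : ℝ) ?_
  linear_combination h3 + h4 + h5 + (u - l) * e

theorem side_S1_max_at_endpoints
    (h Q σ2 η1 η2 : ℝ) (hh : 0 < h) (hQ : 0 < Q) (hσ2 : 0 < σ2)
    (hη1 : 0 ≤ η1) (hη2 : 0 ≤ η2)
    (F : ℝ → ℝ)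
    (hF : ∀ x : ℝ, 0 ≤ x → F x =
      Real.logb 2 (1 + x * h / (Q * η2 + σ2)) +
      Real.logb 2 (1 + Q * h / (x * η1 + σ2)))
    (l x u : ℝ) (hl : 0 ≤ l) (hlx : l ≤ x) (hxu : x ≤ u) :
    F x ≤ max (F l) (F u) := by
  set a := h / (Q * η2 + σ2) with ha
  have ha0 : 0 ≤ a := by positivity
  have hpos : ∀ t, 0 ≤ t → 0 < (1 + a * t) * (1 + Q * h / (t * η1 + σ2)) := by
    intro t ht
    positivity
  have hF' : ∀ t, 0 ≤ t →
      F t = Real.logb 2 ((1 + a * t) * (1 + Q * h / (t * η1 + σ2))) := by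
    intro t ht
    rw [hF t ht, Real.logb_mul (by positivity) (by positivity), ha, mul_comm t h,
      mul_div_right_comm]
  have hx := hl.trans hlx
  have hu := hx.trans hxu
  rw [hF' x hx, hF' l hl, hF' u hu]
  refine le_max_iff.2 ((le_max_iff.1 (mul_one_add_div_le_max (b := Q * h) ha0 hη1 hσ2 hl hlx
    hxu)).imp ?_ ?_) <;>
    exact fun hle => Real.logb_le_logb_of_le one_lt_two (hpos x hx) hle
end

section
/- Let h_d, h_{d1,u}, η1, η2, σ², Pu be positive reals, and for 0 < x < Pu·h_{d1,u}/η1 define G(x) = log₂(1 + x·h_d²/((Pu·h_{d1,u} − x·η1)·η2 + h_d·σ²)) + log₂(1 + (Pu·h_{d1,u} − x·η1)/(x·η1 + σ²)). Then G is differentiable at every such x, and the sign of G'(x) equals the sign of A·x² + B·x + C, where A = −(η1·η2 − h_d²)·η1²·η2, B = 2·η1²·η2·(Pu·h_{d1,u}·η2 + σ²·h_d), and C = −Pu²·h_{d1,u}²·η2²·η1 + Pu·σ²·h_d·h_{d1,u}·η2·(h_d − 2·η1) + σ⁴·h_d²·(h_d − η1). -/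
theorem Real.sign_mul_of_pos {c : ℝ} (hc : 0 < c) (r : ℝ) :
    Real.sign (c * r) = Real.sign r := by
  rcases lt_trichotomy r 0 with h | h | h
  · rw [Real.sign_of_neg h, Real.sign_of_neg (mul_neg_of_pos_of_neg hc h)]
  · simp [h]
  · rw [Real.sign_of_pos h, Real.sign_of_pos (mul_pos hc h)]


theorem sign_of_derivative_on_SU_segment
    (hd hd1u η1 η2 σ2 Pu : ℝ)
    (hhd : 0 < hd) (hhd1u : 0 < hd1u) (hη1 : 0 < η1) (hη2 : 0 < η2)
    (hσ2 : 0 < σ2) (hPu : 0 < Pu)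
    (G : ℝ → ℝ)
    (hG : ∀ x : ℝ, G x =
      Real.logb 2 (1 + x * hd ^ 2 / ((Pu * hd1u - x * η1) * η2 + hd * σ2)) +
      Real.logb 2 (1 + (Pu * hd1u - x * η1) / (x * η1 + σ2)))
    (A B C : ℝ)
    (hA : A = -(η1 * η2 - hd ^ 2) * η1 ^ 2 * η2)
    (hB : B = 2 * η1 ^ 2 * η2 * (Pu * hd1u * η2 + σ2 * hd))
    (hC : C = -(Pu ^ 2 * hd1u ^ 2 * η2 ^ 2 * η1)
      + Pu * σ2 * hd * hd1u * η2 * (hd - 2 * η1)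
      + σ2 ^ 2 * hd ^ 2 * (hd - η1))
    (x : ℝ) (hx0 : 0 < x) (hxu : x < Pu * hd1u / η1) :
    DifferentiableAt ℝ G x ∧
    Real.sign (deriv G x) = Real.sign (A * x ^ 2 + B * x + C) := by
  rw [lt_div_iff₀ hη1] at hxu
  have hP2 : 0 < Pu * hd1u - x * η1 := sub_pos.mpr hxu
  have hD : 0 < (Pu * hd1u - x * η1) * η2 + hd * σ2 := by positivity
  have hE : 0 < x * η1 + σ2 := by positivity
  have hL : 0 < Real.log 2 := Real.log_pos one_lt_two
  have hDx : 0 < (Pu * hd1u - x * η1) * η2 + hd * σ2 + x * hd ^ 2 := by positivity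
  have hlin : HasDerivAt (fun y : ℝ => Pu * hd1u - y * η1) (-η1) x := by
    simpa using ((hasDerivAt_id x).mul_const η1).const_sub (Pu * hd1u)
  have hfst := (((((hasDerivAt_id x).mul_const (hd ^ 2)).div
    ((hlin.mul_const η2).add_const (hd * σ2)) hD.ne').const_add 1).log
      (by simp only [id, Pi.div_apply]; positivity)).div_const (Real.log 2)
  have hsnd := (((hlin.div (((hasDerivAt_id x).mul_const η1).add_const σ2) hE.ne').const_add
    1).log (by simp only [id, Pi.div_apply]; positivity)).div_const (Real.log 2)
  have key : HasDerivAt G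
      ((((Pu * hd1u - x * η1) * η2 + hd * σ2) *
        ((Pu * hd1u - x * η1) * η2 + hd * σ2 + x * hd ^ 2) *
        (x * η1 + σ2) * Real.log 2)⁻¹ * (A * x ^ 2 + B * x + C)) x := by
    rw [show G = _ from funext hG]
    refine (hfst.add hsnd).congr_deriv ?_
    simp only [id, Pi.div_apply]
    have hfst_eq : 1 + x * hd ^ 2 / ((Pu * hd1u - x * η1) * η2 + hd * σ2) =
        ((Pu * hd1u - x * η1) * η2 + hd * σ2 + x * hd ^ 2) /
          ((Pu * hd1u - x * η1) * η2 + hd * σ2) := by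
      field_simp
    have hsnd_eq : 1 + (Pu * hd1u - x * η1) / (x * η1 + σ2) =
        (Pu * hd1u + σ2) / (x * η1 + σ2) := by
      field_simp
      ring
    have hK : 0 < Pu * hd1u + σ2 := by positivity
    rw [hfst_eq, hsnd_eq, hA, hB, hC]
    field_simp
    ring
  refine ⟨key.differentiableAt, ?_⟩
  rw [key.deriv, Real.sign_mul_of_pos (by positivity)]
end

section
/- Let h_d, h_{b,u}, h_{b,d1}, h_{b,d2}, h_{d2,u}, η2 be positive reals and P1, P2, Pu positive reals. If PMC1': P1·h_{b,d1} > Pu·h_{b,u} + P2·h_{b,d2} and PMC4': Pu·h_{d2,u} > P1·h_d + P2·η2 both hold, then both P2·(h_{b,d1}·η2 − h_{b,d2}·h_d) + Pu·(h_{d2,u}·h_{b,d1} − h_{b,u}·h_d) > 0 and P1·(h_{d2,u}·h_{b,d1} − h_d·h_{b,u}) + P2·(h_{d2,u}·h_{b,d2} − h_{b,u}·η2) > 0. -/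
theorem pmc14_second_order_imply_sic
    (hd hbu hbd1 hbd2 hd2u η2 : ℝ)
    (hhd : 0 < hd) (hhbu : 0 < hbu) (hhbd1 : 0 < hbd1) (hhbd2 : 0 < hbd2)
    (hhd2u : 0 < hd2u) (hη2 : 0 < η2)
    (P1 P2 Pu : ℝ) (hP1 : 0 < P1) (hP2 : 0 < P2) (hPu : 0 < Pu)
    (pmc1' : P1 * hbd1 > Pu * hbu + P2 * hbd2)
    (pmc4' : Pu * hd2u > P1 * hd + P2 * η2) :
    P2 * (hbd1 * η2 - hbd2 * hd) + Pu * (hd2u * hbd1 - hbu * hd) > 0 ∧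
    P1 * (hd2u * hbd1 - hd * hbu) + P2 * (hd2u * hbd2 - hbu * η2) > 0 := by
  have h₁ := mul_lt_mul_of_pos_right pmc1' hhd
  have h₂ := mul_lt_mul_of_pos_right pmc4' hhbd1
  have h₃ := mul_lt_mul_of_pos_right pmc1' hhd2u
  have h₄ := mul_lt_mul_of_pos_right pmc4' hhbu
  have h₅ : 0 < P2 * hbd1 * η2 := by positivity
  have h₆ : 0 < P2 * hd2u * hbd2 := by positivity
  constructor <;> linarith
end

section
/- Let h_d, h_{b,u}, h_{b,d2}, h_{d1,u}, η1 be positive reals and P1, P2, Pu positive reals. If PMC3': P2·h_{b,d2} > Pu·h_{b,u} and PMC2': Pu·h_{d1,u} > P2·h_d + P1·η1 both hold, then both P2·(h_{d1,u}·h_{b,d2} − h_{b,u}·h_d) > P1·η1·h_{b,u} and P1·η1·h_{b,d2} > Pu·(h_{b,u}·h_d − h_{d1,u}·h_{b,d2}); in particular h_{d1,u}·h_{b,d2} > h_{b,u}·h_d. -/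
theorem pmc23_second_order_imply_sic
    (hd hbu hbd2 hd1u η1 : ℝ)
    (hhd : 0 < hd) (hhbu : 0 < hbu) (hhbd2 : 0 < hbd2)
    (hhd1u : 0 < hd1u) (hη1 : 0 < η1)
    (P1 P2 Pu : ℝ) (hP1 : 0 < P1) (hP2 : 0 < P2) (hPu : 0 < Pu)
    (pmc3' : P2 * hbd2 > Pu * hbu)
    (pmc2' : Pu * hd1u > P2 * hd + P1 * η1) :
    P2 * (hd1u * hbd2 - hbu * hd) > P1 * η1 * hbu ∧
    P1 * η1 * hbd2 > Pu * (hbu * hd - hd1u * hbd2) ∧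
    hd1u * hbd2 > hbu * hd := by
  have rate_b : P2 * (hd1u * hbd2 - hbu * hd) > P1 * η1 * hbu := by
    linarith [mul_lt_mul_of_pos_right pmc3' hhd1u, mul_lt_mul_of_pos_right pmc2' hhbu]
  have gain : 0 < hd1u * hbd2 - hbu * hd :=
    pos_of_mul_pos_right (lt_trans (by positivity) rate_b) hP2.le
  have rate_d1 : 0 < P1 * η1 * hbd2 := by positivity
  exact ⟨rate_b, by linarith [mul_pos hPu gain], sub_pos.mp gain⟩
end
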